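/- In the symplectic space V = F_2^4 of 2-torsion points with the intersection-parity form, for every Weber hexad W and every element α ∈ V \ W there is a unique decomposition W = G △ R with G a Göpel tetrad, R a Rosenhain tetrad, and G ∩ R = {α}. -/

import Mathlib

/-- `V` = partitions of {1,…,6} into two even-size parts, represented by the
part of size 0 or 2. -/
def isV (s : Finset (Fin 6)) : Prop := s.card = 0 ∨ s.card = 2

/-- Addition on `V`: normalized symmetric difference. -/
def vadd (a b : Finset (Fin 6)) : Finset (Fin 6) :=
  if (symmDiff a b).card = 4 then (symmDiff a b)ᶜ else symmDiff a b

/-- The intersection-parity symplectic form `b([α],[α']) = #(α ∩ α') mod 2`. -/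
def bform (a b : Finset (Fin 6)) : ZMod 2 := ((a ∩ b).card : ZMod 2)

/-- A 2-dimensional subspace of `V = F_2^4`: a subgroup with 4 elements. -/
def IsSubspace2 (S : Finset (Finset (Fin 6))) : Prop :=
  S.card = 4 ∧ (∀ a ∈ S, isV a) ∧ ∅ ∈ S ∧ ∀ a ∈ S, ∀ b ∈ S, vadd a b ∈ S

/-- A Göpel subgroup: a totally isotropic 2-dimensional subspace. -/
def IsGopelSubgroup (S : Finset (Finset (Fin 6))) : Prop :=
  IsSubspace2 S ∧ ∀ a ∈ S, ∀ b ∈ S, bform a b = 0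

/-- A Rosenhain subgroup: a 2-dimensional subspace which is not totally isotropic. -/
def IsRosenhainSubgroup (S : Finset (Finset (Fin 6))) : Prop :=
  IsSubspace2 S ∧ ∃ a ∈ S, ∃ b ∈ S, bform a b ≠ 0

/-- A Göpel tetrad: a coset (translate) of a Göpel subgroup. -/
def IsGopelTetrad (t : Finset (Finset (Fin 6))) : Prop :=
  ∃ S v, IsGopelSubgroup S ∧ isV v ∧ t = S.image (vadd v)

/-- A Rosenhain tetrad: a coset (translate) of a Rosenhain subgroup. -/
def IsRosenhainTetrad (t : Finset (Finset (Fin 6))) : Prop :=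
  ∃ S v, IsRosenhainSubgroup S ∧ isV v ∧ t = S.image (vadd v)

/-- A Weber hexad: a 6-element set which is the symmetric difference of a
Göpel tetrad and a Rosenhain tetrad. -/
def IsWeberHexad (w : Finset (Finset (Fin 6))) : Prop :=
  w.card = 6 ∧ ∃ G R, IsGopelTetrad G ∧ IsRosenhainTetrad R ∧ w = symmDiff G R

instance (s : Finset (Fin 6)) : Decidable (isV s) := by unfold isV; infer_instance

/-! ### Coding elements of `V` by numbers below 16 (linearly), and subsets by bit masks -/

def elemCode (s : Finset (Fin 6)) : ℕ :=
  (if 0 ∈ s then 1 else 0) ^^^ (if 1 ∈ s then 2 else 0) ^^^ (if 2 ∈ s then 4 else 0) ^^^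
  (if 3 ∈ s then 8 else 0) ^^^ (if 5 ∈ s then 15 else 0)

def parityN (x : ℕ) : ℕ := (x ^^^ (x >>> 1) ^^^ (x >>> 2) ^^^ (x >>> 3)) &&& 1

def formN (a b : ℕ) : ℕ := parityN (a &&& b) ^^^ (parityN a &&& parityN b)

def maskN (v a b : ℕ) : ℕ :=
  (1 <<< v) ||| (1 <<< (v ^^^ a)) ||| (1 <<< (v ^^^ b)) ||| (1 <<< (v ^^^ (a ^^^ b)))

def decodeSet (m : ℕ) : Finset (Finset (Fin 6)) :=
  Finset.univ.filter (fun x => isV x ∧ m.testBit (elemCode x) = true)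

def popN (m : ℕ) : ℕ := ((List.range 16).filter (fun i => m.testBit i)).length

def gopelCodes : List ℕ := [
  60, 90, 102, 153, 165, 195, 780, 816, 1290, 1360, 1542, 1632, 2313, 2448, 2565, 2720, 3075,
  3264, 4386, 4420, 4626, 4680, 5140, 5160, 8481, 8580, 8721, 8840, 10260, 10280, 12291, 12480,
  15360, 16705, 16770, 17425, 17544, 18450, 18504, 20485, 20640, 23040, 24582, 24672, 26112,
  33345, 33410, 33825, 33924, 34850, 34884, 36873, 37008, 39168, 40970, 41040, 42240, 49164,
  49200, 49920]

def rosenCodes : List ℕ := [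
  15, 51, 85, 105, 150, 170, 204, 240, 771, 960, 1285, 1440, 1545, 1680, 2310, 2400, 2570,
  2640, 3084, 3120, 3840, 4369, 4488, 4641, 4740, 5185, 5250, 6168, 6180, 6210, 6273, 8466,
  8520, 8738, 8772, 9240, 9252, 9282, 9345, 10305, 10370, 12300, 12336, 13056, 16660, 16680,
  16920, 16932, 16962, 17025, 17442, 17476, 18465, 18564, 20490, 20560, 21760, 24585, 24720,
  26880, 33048, 33060, 33090, 33153, 33300, 33320, 33810, 33864, 34833, 34952, 36870, 36960,
  38400, 40965, 41120, 43520, 49155, 49344, 52224, 61440]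

def weberCodes : List ℕ := [
  857, 869, 922, 934, 1337, 1379, 1436, 1478, 1589, 1619, 1708, 1738, 2362, 2396, 2467, 2501,
  2614, 2668, 2707, 2761, 3158, 3178, 3221, 3241, 4397, 4427, 4532, 4562, 4637, 4679, 4792,
  4834, 5147, 5159, 5336, 5348, 6932, 6952, 7442, 7496, 7714, 7748, 8494, 8564, 8587, 8657,
  8734, 8824, 8839, 8929, 10004, 10024, 10267, 10279, 10456, 10468, 11537, 11656, 11809, 11908,
  12374, 12394, 12437, 12457, 13574, 13664, 13834, 13904, 14597, 14752, 14857, 14992, 16718,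
  16754, 16781, 16817, 17438, 17528, 17543, 17633, 18194, 18248, 18461, 18503, 18616, 18658,
  19217, 19336, 20033, 20098, 20534, 20588, 20627, 20681, 21254, 21344, 22028, 22064, 22787,
  22976, 23561, 23696, 24629, 24659, 24748, 24778, 25349, 25504, 25859, 26048, 27148, 27184,
  27658, 27728, 29249, 29314, 29729, 29828, 30754, 30788, 33358, 33394, 33421, 33457, 33838,
  33908, 33931, 34001, 34594, 34628, 34861, 34891, 34996, 35026, 35617, 35716, 36161, 36226,
  36922, 36956, 37027, 37061, 37642, 37712, 38156, 38192, 39427, 39616, 39941, 40096, 41017,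
  41059, 41116, 41158, 41737, 41872, 42499, 42688, 43276, 43312, 44038, 44128, 45377, 45442,
  46097, 46216, 47122, 47176, 49241, 49253, 49306, 49318, 50441, 50576, 50693, 50848, 51466,
  51536, 51718, 51808, 53537, 53636, 53777, 53896, 55316, 55336, 57634, 57668, 57874, 57928,
  58388, 58408]

/-! Kernel-friendly list searches -/

noncomputable def memN (n : ℕ) (l : List ℕ) : Bool :=
  List.rec false (fun x _ ih => Bool.rec ih true (Nat.beq n x)) l

noncomputable def allN (p : ℕ → Bool) (l : List ℕ) : Bool :=
  List.rec true (fun x _ ih => Bool.rec false ih (p x)) l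

noncomputable def orN (a b : Bool) : Bool := Bool.rec b true a

noncomputable def andN (a b : Bool) : Bool := Bool.rec false b a

theorem orN_iff (a b : Bool) : orN a b = true ↔ a = true ∨ b = true := by
  cases a <;> cases b <;> simp [orN]

theorem andN_iff (a b : Bool) : andN a b = true ↔ a = true ∧ b = true := by
  cases a <;> cases b <;> simp [andN]

theorem memN_iff (n : ℕ) (l : List ℕ) : memN n l = true ↔ n ∈ l := by
  induction l with
  | nil => simp [memN]
  | cons x l ih =>
    have h : memN n (x :: l) = orN (Nat.beq n x) (memN n l) := rfl
    rw [h, orN_iff, ih, Nat.beq_eq, List.mem_cons]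

theorem allN_iff (p : ℕ → Bool) (l : List ℕ) : allN p l = true ↔ ∀ x ∈ l, p x = true := by
  induction l with
  | nil => simp [allN]
  | cons x l ih =>
    have h : allN p (x :: l) = andN (p x) (allN p l) := rfl
    rw [h, andN_iff, ih, List.forall_mem_cons]

theorem elemCode_lt : ∀ a : Finset (Fin 6), elemCode a < 16 := by decide +kernel

theorem elemCode_inj : ∀ a : Finset (Fin 6), isV a → ∀ b : Finset (Fin 6), isV b →
    elemCode a = elemCode b → a = b := by decide +kernel

theorem elemCode_surj : ∀ i < 16, ∃ a : Finset (Fin 6), isV a ∧ elemCode a = i := by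
  decide +kernel

theorem vadd_facts : ∀ a : Finset (Fin 6), isV a → ∀ b : Finset (Fin 6), isV b →
    isV (vadd a b) ∧ elemCode (vadd a b) = elemCode a ^^^ elemCode b ∧
    (bform a b = 0 ↔ formN (elemCode a) (elemCode b) = 0) := by decide +kernel

theorem formN_cases : ∀ a < 16, ∀ b < 16, formN a b = 0 ∨ formN a b = 1 := by decide +kernel

theorem bform_self_facts : ∀ a : Finset (Fin 6), isV a → bform a a = 0 ∧ bform ∅ a = 0 ∧
    bform a ∅ = 0 ∧ vadd a ∅ = a := by decide +kernel

theorem isV_empty : isV ∅ := Or.inl rfl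

theorem pair_facts : ∀ a : Finset (Fin 6), isV a → ∀ b : Finset (Fin 6), isV b →
    vadd a (vadd a b) = b ∧ vadd b (vadd a b) = a ∧ vadd (vadd a b) a = b ∧
    vadd (vadd a b) b = a ∧ vadd b a = vadd a b := by decide +kernel

theorem pair_form_facts : ∀ a : Finset (Fin 6), isV a → ∀ b : Finset (Fin 6), isV b →
    bform a b = 0 → bform a (vadd a b) = 0 ∧ bform b (vadd a b) = 0 := by decide +kernel

theorem self_facts : ∀ a : Finset (Fin 6), isV a → vadd a a = ∅ ∧ vadd ∅ a = a := by
  decide +kernel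

theorem bform_comm' (a b : Finset (Fin 6)) : bform a b = bform b a := by
  rw [bform, bform, Finset.inter_comm]

theorem sub_facts (a : Finset (Fin 6)) (ha : isV a) (b : Finset (Fin 6)) (hb : isV b)
    (ha0 : a ≠ ∅) (hb0 : b ≠ ∅) (hab : a ≠ b) :
    ({∅, a, b, vadd a b} : Finset (Finset (Fin 6))).card = 4 ∧
    (∀ x ∈ ({∅, a, b, vadd a b} : Finset (Finset (Fin 6))),
      ∀ y ∈ ({∅, a, b, vadd a b} : Finset (Finset (Fin 6))),
      vadd x y ∈ ({∅, a, b, vadd a b} : Finset (Finset (Fin 6))) ∧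
      (bform a b = 0 → bform x y = 0)) := by
  obtain ⟨p1, p2, p3, p4, p5⟩ := pair_facts a ha b hb
  have hc := (vadd_facts a ha b hb).1
  obtain ⟨a1, -, a3, a4⟩ := bform_self_facts a ha
  obtain ⟨b1, -, b3, b4⟩ := bform_self_facts b hb
  obtain ⟨c1, -, c3, c4⟩ := bform_self_facts _ hc
  obtain ⟨a5, a6⟩ := self_facts a ha
  obtain ⟨b5, b6⟩ := self_facts b hb
  obtain ⟨c5, c6⟩ := self_facts _ hc
  have e0 : vadd ∅ ∅ = (∅ : Finset (Fin 6)) := (self_facts ∅ isV_empty).1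
  have f0 : bform ∅ ∅ = 0 := (bform_self_facts ∅ isV_empty).1
  constructor
  · have n1 : ∅ ≠ vadd a b := by
      intro h
      rw [← h, a4] at p1
      exact hab p1
    have n2 : a ≠ vadd a b := by
      intro h
      rw [← h, a5] at p1
      exact hb0 p1.symm
    have n3 : b ≠ vadd a b := by
      intro h
      rw [← h, b5] at p2
      exact ha0 p2.symm
    rw [Finset.card_insert_of_notMem, Finset.card_insert_of_notMem,
      Finset.card_insert_of_notMem, Finset.card_singleton]
    · simpa using n3
    · simpa using ⟨hab, n2⟩
    · simpa using ⟨ha0.symm, hb0.symm, n1⟩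
  · intro x hx y hy
    simp only [Finset.mem_insert, Finset.mem_singleton] at hx hy
    constructor
    · rcases hx with rfl | rfl | rfl | rfl <;> rcases hy with rfl | rfl | rfl | rfl <;>
        simp only [Finset.mem_insert, Finset.mem_singleton, *, true_or, or_true]
    · intro hf
      obtain ⟨q1, q2⟩ := pair_form_facts a ha b hb hf
      have a3' := (bform_comm' _ _).trans a3
      have b3' := (bform_comm' _ _).trans b3
      have c3' := (bform_comm' _ _).trans c3
      have q1' := (bform_comm' _ _).trans q1
      have q2' := (bform_comm' _ _).trans q2
      have hf' := (bform_comm' _ _).trans hf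
      rcases hx with rfl | rfl | rfl | rfl <;> rcases hy with rfl | rfl | rfl | rfl <;>
        assumption

def Tet (c : ℕ) (t : Finset (Finset (Fin 6))) : Prop :=
  ∃ v a b, isV v ∧ isV a ∧ isV b ∧ a ≠ ∅ ∧ b ≠ ∅ ∧ a ≠ b ∧
    formN (elemCode a) (elemCode b) = c ∧
    t = ({∅, a, b, vadd a b} : Finset (Finset (Fin 6))).image (vadd v)

theorem subspace_eq {S : Finset (Finset (Fin 6))} (hS : IsSubspace2 S)
    {a b : Finset (Fin 6)} (ha : a ∈ S) (hb : b ∈ S) (ha0 : a ≠ ∅) (hb0 : b ≠ ∅)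
    (hab : a ≠ b) : S = {∅, a, b, vadd a b} := by
  obtain ⟨hc, hV, h0, hadd⟩ := hS
  symm
  apply Finset.eq_of_subset_of_card_le
  · intro x hx
    simp only [Finset.mem_insert, Finset.mem_singleton] at hx
    rcases hx with rfl | rfl | rfl | rfl
    · exact h0
    · exact ha
    · exact hb
    · exact hadd _ ha _ hb
  · rw [hc, (sub_facts a (hV a ha) b (hV b hb) ha0 hb0 hab).1]

theorem subspace_of {a b : Finset (Fin 6)} (ha : isV a) (hb : isV b) (ha0 : a ≠ ∅)
    (hb0 : b ≠ ∅) (hab : a ≠ b) : IsSubspace2 {∅, a, b, vadd a b} := by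
  have h := sub_facts a ha b hb ha0 hb0 hab
  refine ⟨h.1, ?_, by simp, fun x hx y hy => (h.2 x hx y hy).1⟩
  intro x hx
  simp only [Finset.mem_insert, Finset.mem_singleton] at hx
  rcases hx with rfl | rfl | rfl | rfl
  · exact isV_empty
  · exact ha
  · exact hb
  · exact (vadd_facts _ ha _ hb).1

theorem gopel_iff (t : Finset (Finset (Fin 6))) : IsGopelTetrad t ↔ Tet 0 t := by
  constructor
  · rintro ⟨S, v, ⟨hS, hiso⟩, hv, rfl⟩
    obtain ⟨a, ha, ha0⟩ : ∃ a ∈ S, a ≠ ∅ :=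
      Finset.exists_mem_ne (by rw [hS.1]; norm_num) ∅
    obtain ⟨b, hb, hb'⟩ : ∃ b ∈ S, b ∉ ({∅, a} : Finset (Finset (Fin 6))) := by
      apply Finset.exists_mem_notMem_of_card_lt_card
      rw [hS.1]
      exact lt_of_le_of_lt Finset.card_le_two (by norm_num)
    simp only [Finset.mem_insert, Finset.mem_singleton, not_or] at hb'
    have hab : a ≠ b := fun h => hb'.2 h.symm
    refine ⟨v, a, b, hv, hS.2.1 a ha, hS.2.1 b hb, ha0, hb'.1, hab, ?_, ?_⟩
    · exact (vadd_facts a (hS.2.1 a ha) b (hS.2.1 b hb)).2.2.1 (hiso a ha b hb)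
    · rw [← subspace_eq hS ha hb ha0 hb'.1 hab]
  · rintro ⟨v, a, b, hv, ha, hb, ha0, hb0, hab, hf, rfl⟩
    refine ⟨_, v, ⟨subspace_of ha hb ha0 hb0 hab, fun x hx y hy => ?_⟩, hv, rfl⟩
    exact ((sub_facts a ha b hb ha0 hb0 hab).2 x hx y hy).2
      ((vadd_facts a ha b hb).2.2.2 hf)

theorem rosen_iff (t : Finset (Finset (Fin 6))) : IsRosenhainTetrad t ↔ Tet 1 t := by
  constructor
  · rintro ⟨S, v, ⟨hS, a, ha, b, hb, hne⟩, hv, rfl⟩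
    have hVa := hS.2.1 a ha
    have hVb := hS.2.1 b hb
    have ha0 : a ≠ ∅ := by
      rintro rfl
      exact hne (bform_self_facts b hVb).2.1
    have hb0 : b ≠ ∅ := by
      rintro rfl
      exact hne (bform_self_facts a hVa).2.2.1
    have hab : a ≠ b := by
      rintro rfl
      exact hne (bform_self_facts a hVa).1
    refine ⟨v, a, b, hv, hVa, hVb, ha0, hb0, hab, ?_, ?_⟩
    · rcases formN_cases _ (elemCode_lt a) _ (elemCode_lt b) with h | h
      · exact absurd ((vadd_facts a hVa b hVb).2.2.2 h) hne
      · exact h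
    · rw [← subspace_eq hS ha hb ha0 hb0 hab]
  · rintro ⟨v, a, b, hv, ha, hb, ha0, hb0, hab, hf, rfl⟩
    refine ⟨_, v, ⟨subspace_of ha hb ha0 hb0 hab, a, by simp, b, by simp, fun h => ?_⟩, hv, rfl⟩
    have := (vadd_facts a ha b hb).2.2.1 h
    omega

theorem mem_decodeSet (m : ℕ) (x : Finset (Fin 6)) :
    x ∈ decodeSet m ↔ isV x ∧ m.testBit (elemCode x) = true := by
  simp [decodeSet]

theorem testBit_one_shift (i j : ℕ) : (1 <<< i).testBit j = decide (j = i) := by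
  rw [Nat.one_shiftLeft, Nat.testBit_two_pow]
  simp [eq_comm]

theorem tet_decode {v a b : Finset (Fin 6)} (hv : isV v) (ha : isV a) (hb : isV b) :
    ({∅, a, b, vadd a b} : Finset (Finset (Fin 6))).image (vadd v) =
      decodeSet (maskN (elemCode v) (elemCode a) (elemCode b)) := by
  have hab := vadd_facts a ha b hb
  have h1 := vadd_facts v hv a ha
  have h2 := vadd_facts v hv b hb
  have h3 := vadd_facts v hv _ hab.1
  have key : ∀ y, isV y → ∀ x, (x = y ↔ isV x ∧ elemCode x = elemCode y) := by
    intro y hy x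
    constructor
    · rintro rfl
      exact ⟨hy, rfl⟩
    · rintro ⟨hx, h⟩
      exact elemCode_inj x hx y hy h
  ext x
  rw [mem_decodeSet]
  simp only [Finset.image_insert, Finset.image_singleton, Finset.mem_insert,
    Finset.mem_singleton, (bform_self_facts v hv).2.2.2]
  rw [key _ hv x, key _ h1.1 x, key _ h2.1 x, key _ h3.1 x, h1.2.1, h2.2.1, h3.2.1, hab.2.1]
  simp only [maskN, Nat.testBit_or, testBit_one_shift, Bool.or_eq_true, decide_eq_true_eq,
    ← and_or_left, or_assoc]

def codes16 : List ℕ := [0, 1, 2, 3, 4, 5, 6, 7, 8, 9, 10, 11, 12, 13, 14, 15]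

theorem mem_codes16 : ∀ i < 16, i ∈ codes16 := by decide

noncomputable def completeAt (a b v : ℕ) : Bool :=
  orN (Nat.beq a 0) (orN (Nat.beq b 0) (orN (Nat.beq a b)
    (Bool.rec (memN (maskN v a b) rosenCodes) (memN (maskN v a b) gopelCodes)
      (Nat.beq (formN a b) 0))))

theorem completeAt_all' : allN (fun a => allN (fun b => allN (fun v => completeAt a b v)
    codes16) codes16) codes16 = true := by
  decide +kernel

theorem completeAt_all (a : ℕ) (ha : a < 16) (b : ℕ) (hb : b < 16) (v : ℕ) (hv : v < 16) :
    completeAt a b v = true := by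
  have h := completeAt_all'
  simp only [allN_iff] at h
  exact h a (mem_codes16 a ha) b (mem_codes16 b hb) v (mem_codes16 v hv)

theorem codes_complete (a : ℕ) (ha : a < 16) (b : ℕ) (hb : b < 16) (v : ℕ) (hv : v < 16)
    (h : a ≠ 0 ∧ b ≠ 0 ∧ a ≠ b) :
    (formN a b = 0 → maskN v a b ∈ gopelCodes) ∧
    (formN a b = 1 → maskN v a b ∈ rosenCodes) := by
  have hc := completeAt_all a ha b hb v hv
  obtain ⟨h1, h2, h3⟩ := h
  constructor
  · intro hf
    simp only [completeAt, orN_iff, Nat.beq_eq, h1, h2, h3, false_or] at hc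
    rw [hf] at hc
    exact (memN_iff _ _).1 hc
  · intro hf
    simp only [completeAt, orN_iff, Nat.beq_eq, h1, h2, h3, false_or] at hc
    rw [hf] at hc
    exact (memN_iff _ _).1 hc

theorem gopelCodes_sound : ∀ m ∈ gopelCodes, ∃ v < 16, m.testBit v = true ∧
    ∃ a < 16, a ≠ 0 ∧ m.testBit (v ^^^ a) = true ∧ ∃ b < 16, b ≠ 0 ∧ a ≠ b ∧
    formN a b = 0 ∧ m = maskN v a b := by decide +kernel

theorem rosenCodes_sound : ∀ m ∈ rosenCodes, ∃ v < 16, m.testBit v = true ∧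
    ∃ a < 16, a ≠ 0 ∧ m.testBit (v ^^^ a) = true ∧ ∃ b < 16, b ≠ 0 ∧ a ≠ b ∧
    formN a b = 1 ∧ m = maskN v a b := by decide +kernel

theorem codes_lt : (∀ m ∈ gopelCodes, m < 2 ^ 16) ∧ (∀ m ∈ rosenCodes, m < 2 ^ 16) ∧
    (∀ m ∈ weberCodes, m < 2 ^ 16) := by decide +kernel

theorem elemCode_ne_zero {a : Finset (Fin 6)} (ha : isV a) (h : a ≠ ∅) : elemCode a ≠ 0 :=
  fun h' => h (elemCode_inj a ha ∅ isV_empty (by rw [h']; rfl))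

theorem tet_of_codes {c v a b : ℕ} (hv : v < 16) (ha : a < 16) (hb : b < 16) (ha0 : a ≠ 0)
    (hb0 : b ≠ 0) (hab : a ≠ b) (hf : formN a b = c) : Tet c (decodeSet (maskN v a b)) := by
  obtain ⟨v, hvV, rfl⟩ := elemCode_surj v hv
  obtain ⟨a, haV, rfl⟩ := elemCode_surj a ha
  obtain ⟨b, hbV, rfl⟩ := elemCode_surj b hb
  refine ⟨v, a, b, hvV, haV, hbV, ?_, ?_, ?_, hf, (tet_decode hvV haV hbV).symm⟩
  · rintro rfl
    exact ha0 rfl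
  · rintro rfl
    exact hb0 rfl
  · rintro rfl
    exact hab rfl

theorem gopel_codes (t : Finset (Finset (Fin 6))) :
    IsGopelTetrad t ↔ ∃ m ∈ gopelCodes, t = decodeSet m := by
  rw [gopel_iff]
  constructor
  · rintro ⟨v, a, b, hv, ha, hb, ha0, hb0, hab, hf, rfl⟩
    exact ⟨_, (codes_complete _ (elemCode_lt a) _ (elemCode_lt b) _ (elemCode_lt v)
      ⟨elemCode_ne_zero ha ha0, elemCode_ne_zero hb hb0,
        fun h => hab (elemCode_inj a ha b hb h)⟩).1 hf, tet_decode hv ha hb⟩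
  · rintro ⟨m, hm, rfl⟩
    obtain ⟨v, hv, -, a, ha, ha0, -, b, hb, hb0, hab, hf, rfl⟩ := gopelCodes_sound m hm
    exact tet_of_codes hv ha hb ha0 hb0 hab hf

theorem rosen_codes (t : Finset (Finset (Fin 6))) :
    IsRosenhainTetrad t ↔ ∃ m ∈ rosenCodes, t = decodeSet m := by
  rw [rosen_iff]
  constructor
  · rintro ⟨v, a, b, hv, ha, hb, ha0, hb0, hab, hf, rfl⟩
    exact ⟨_, (codes_complete _ (elemCode_lt a) _ (elemCode_lt b) _ (elemCode_lt v)
      ⟨elemCode_ne_zero ha ha0, elemCode_ne_zero hb hb0,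
        fun h => hab (elemCode_inj a ha b hb h)⟩).2 hf, tet_decode hv ha hb⟩
  · rintro ⟨m, hm, rfl⟩
    obtain ⟨v, hv, -, a, ha, ha0, -, b, hb, hb0, hab, hf, rfl⟩ := rosenCodes_sound m hm
    exact tet_of_codes hv ha hb ha0 hb0 hab hf

theorem decodeSet_xor (m n : ℕ) :
    symmDiff (decodeSet m) (decodeSet n) = decodeSet (m ^^^ n) := by
  ext x
  simp only [Finset.mem_symmDiff, mem_decodeSet, Nat.testBit_xor]
  cases m.testBit (elemCode x) <;> cases n.testBit (elemCode x) <;> simp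

theorem decodeSet_and (m n : ℕ) :
    decodeSet m ∩ decodeSet n = decodeSet (m &&& n) := by
  ext x
  simp only [Finset.mem_inter, mem_decodeSet, Nat.testBit_and, Bool.and_eq_true]
  tauto

theorem decodeSet_single {α : Finset (Fin 6)} (hα : isV α) :
    decodeSet (1 <<< elemCode α) = {α} := by
  ext x
  simp only [mem_decodeSet, testBit_one_shift, decide_eq_true_eq, Finset.mem_singleton]
  constructor
  · rintro ⟨hx, h⟩
    exact elemCode_inj x hx α hα h
  · rintro rfl
    exact ⟨hα, rfl⟩

theorem decodeSet_inj {m n : ℕ} (hm : m < 2 ^ 16) (hn : n < 2 ^ 16)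
    (h : decodeSet m = decodeSet n) : m = n := by
  apply Nat.eq_of_testBit_eq
  intro i
  by_cases hi : i < 16
  · obtain ⟨a, ha, rfl⟩ := elemCode_surj i hi
    have := congrArg (fun s => a ∈ s) h
    simp only [mem_decodeSet, ha, true_and, eq_iff_iff] at this
    exact Bool.eq_iff_iff.2 this
  · have hp : 2 ^ 16 ≤ 2 ^ i := Nat.pow_le_pow_right (by norm_num) (by omega)
    rw [Nat.testBit_lt_two_pow (lt_of_lt_of_le hm hp),
      Nat.testBit_lt_two_pow (lt_of_lt_of_le hn hp)]

theorem decodeSet_card (m : ℕ) : (decodeSet m).card = popN m := by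
  have h : (decodeSet m).image elemCode
      = ((List.range 16).filter (fun i => m.testBit i)).toFinset := by
    ext i
    simp only [Finset.mem_image, mem_decodeSet, List.mem_toFinset, List.mem_filter,
      List.mem_range]
    constructor
    · rintro ⟨a, ⟨-, h⟩, rfl⟩
      exact ⟨elemCode_lt a, h⟩
    · rintro ⟨hi, h⟩
      obtain ⟨a, ha, rfl⟩ := elemCode_surj i hi
      exact ⟨a, ⟨ha, h⟩, rfl⟩
  have hc := congrArg Finset.card h
  rw [Finset.card_image_of_injOn, List.toFinset_card_of_nodup] at hc
  · exact hc
  · exact List.nodup_range.filter _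
  · intro a ha b hb hab
    simp only [Finset.mem_coe, mem_decodeSet] at ha hb
    exact elemCode_inj a ha.1 b hb.1 hab

def points16 : List ℕ :=
  [1, 2, 4, 8, 16, 32, 64, 128, 256, 512, 1024, 2048, 4096, 8192, 16384, 32768]

theorem mem_points16 : ∀ i < 16, 1 <<< i ∈ points16 := by decide +kernel

theorem pop_four : (∀ m ∈ gopelCodes, popN m = 4) ∧ (∀ m ∈ rosenCodes, popN m = 4) := by
  decide +kernel

theorem weber_complete' : allN (fun g => allN (fun r =>
    Bool.rec true (memN (Nat.xor g r) weberCodes) (memN (Nat.land g r) points16)) rosenCodes)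
    gopelCodes = true := by decide +kernel

theorem weber_complete (g : ℕ) (hg : g ∈ gopelCodes) (r : ℕ) (hr : r ∈ rosenCodes)
    (hcard : (decodeSet (g ^^^ r)).card = 6) : g ^^^ r ∈ weberCodes := by
  have h := weber_complete'
  simp only [allN_iff] at h
  have h := h g hg r hr
  have c1 : (decodeSet g).card = 4 := by rw [decodeSet_card, pop_four.1 g hg]
  have c2 : (decodeSet r).card = 4 := by rw [decodeSet_card, pop_four.2 r hr]
  have hone : (decodeSet g ∩ decodeSet r).card = 1 := by
    rw [← decodeSet_xor, Finset.symmDiff_def,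
      Finset.card_union_of_disjoint disjoint_sdiff_sdiff] at hcard
    have k1 := Finset.card_sdiff_add_card_inter (decodeSet g) (decodeSet r)
    have k2 := Finset.card_sdiff_add_card_inter (decodeSet r) (decodeSet g)
    rw [Finset.inter_comm] at k2
    omega
  obtain ⟨β, hβ⟩ := Finset.card_eq_one.1 hone
  have hβV : isV β := by
    have : β ∈ decodeSet g ∩ decodeSet r := by rw [hβ]; simp
    exact ((mem_decodeSet g β).1 (Finset.mem_inter.1 this).1).1
  rw [decodeSet_and, ← decodeSet_single hβV] at hβ
  have hlt : 1 <<< elemCode β < 2 ^ 16 := by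
    rw [Nat.one_shiftLeft]
    exact Nat.pow_lt_pow_right (by norm_num) (elemCode_lt β)
  have he : Nat.land g r = 1 <<< elemCode β :=
    decodeSet_inj (Nat.and_lt_two_pow _ (codes_lt.2.1 r hr)) hlt hβ
  have hm : memN (Nat.land g r) points16 = true := by
    rw [memN_iff, he]
    exact mem_points16 _ (elemCode_lt β)
  rw [hm] at h
  exact (memN_iff _ _).1 h

/-- The Göpel codes (from the list `l`) giving a decomposition of `w` with intersection
the point with mask `p`. -/
noncomputable def decomps (w p : ℕ) (l : List ℕ) : List ℕ :=
  List.rec [] (fun g _ ih => Bool.rec ih (g :: ih)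
    (andN (Nat.beq (Nat.land g (Nat.xor g w)) p) (memN (Nat.xor g w) rosenCodes))) l

theorem mem_decomps (w p x : ℕ) (l : List ℕ) : x ∈ decomps w p l ↔
    x ∈ l ∧ x &&& (x ^^^ w) = p ∧ x ^^^ w ∈ rosenCodes := by
  induction l with
  | nil => simp [decomps]
  | cons g l ih =>
    have h : decomps w p (g :: l) = Bool.rec (decomps w p l) (g :: decomps w p l)
      (andN (Nat.beq (Nat.land g (Nat.xor g w)) p) (memN (Nat.xor g w) rosenCodes)) := rfl
    have hc : andN (Nat.beq (Nat.land g (Nat.xor g w)) p) (memN (Nat.xor g w) rosenCodes) = true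
        ↔ g &&& (g ^^^ w) = p ∧ g ^^^ w ∈ rosenCodes := by
      rw [andN_iff, memN_iff, Nat.beq_eq]
      rfl
    rw [h, List.mem_cons]
    generalize andN (Nat.beq (Nat.land g (Nat.xor g w)) p) (memN (Nat.xor g w) rosenCodes) = c
      at hc
    cases c
    · have hn : ¬ (g &&& (g ^^^ w) = p ∧ g ^^^ w ∈ rosenCodes) := by
        rw [← hc]
        simp
      change x ∈ decomps w p l ↔ _
      rw [ih]
      constructor
      · rintro ⟨h1, h2⟩
        exact ⟨Or.inr h1, h2⟩
      · rintro ⟨rfl | h1, h2⟩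
        · exact absurd h2 hn
        · exact ⟨h1, h2⟩
    · have hy := hc.1 rfl
      change x ∈ g :: decomps w p l ↔ _
      rw [List.mem_cons, ih]
      constructor
      · rintro (rfl | ⟨h1, h2⟩)
        · exact ⟨Or.inl rfl, hy⟩
        · exact ⟨Or.inr h1, h2⟩
      · rintro ⟨rfl | h1, h2⟩
        · exact Or.inl rfl
        · exact Or.inr ⟨h1, h2⟩

noncomputable def isSingle (l : List ℕ) : Bool :=
  List.rec false (fun _ t _ => List.rec true (fun _ _ _ => false) t) l

theorem isSingle_spec (l : List ℕ) (h : isSingle l = true) : ∃ x, l = [x] := by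
  match l, h with
  | [], h => exact absurd h (by simp [isSingle])
  | [x], _ => exact ⟨x, rfl⟩
  | _ :: _ :: _, h => exact absurd h (by simp [isSingle])

theorem decomps_unique' : allN (fun w => allN (fun p =>
    Bool.rec true (isSingle (decomps w p gopelCodes)) (Nat.beq (Nat.land w p) 0)) points16)
    weberCodes = true := by decide +kernel

theorem decomps_unique (w : ℕ) (hw : w ∈ weberCodes) (i : ℕ) (hi : i < 16)
    (hb : w.testBit i = false) : ∃ x, decomps w (1 <<< i) gopelCodes = [x] := by
  have h := decomps_unique'
  simp only [allN_iff] at h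
  have h := h w hw _ (mem_points16 i hi)
  have hz : w &&& (1 <<< i) = 0 := by
    apply Nat.eq_of_testBit_eq
    intro j
    rw [Nat.testBit_and, testBit_one_shift, Nat.zero_testBit]
    by_cases hj : j = i
    · rw [hj, hb, Bool.false_and]
    · simp [hj]
  have hz' : Nat.beq (Nat.land w (1 <<< i)) 0 = true := by
    rw [Nat.beq_eq]
    exact hz
  rw [hz'] at h
  exact isSingle_spec _ h

/-- for every Weber hexad `W` and every `α ∈ V \ W` there is a
unique decomposition `W = G △ R` with `G` a Göpel tetrad, `R` a Rosenhain
tetrad and `G ∩ R = {α}`. -/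
theorem weber_hexad_unique_decomposition (w : Finset (Finset (Fin 6)))
    (hw : IsWeberHexad w) (α : Finset (Fin 6)) (hα : isV α) (hαw : α ∉ w) :
    ∃! p : Finset (Finset (Fin 6)) × Finset (Finset (Fin 6)),
      IsGopelTetrad p.1 ∧ IsRosenhainTetrad p.2 ∧
      p.1 ∩ p.2 = {α} ∧ w = symmDiff p.1 p.2 := by
  obtain ⟨hcard, G, R, hG, hR, rfl⟩ := hw
  obtain ⟨g, hg, rfl⟩ := (gopel_codes G).1 hG
  obtain ⟨r, hr, rfl⟩ := (rosen_codes R).1 hR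
  rw [decodeSet_xor] at hcard hαw ⊢
  have hw := weber_complete g hg r hr hcard
  generalize g ^^^ r = w at *
  have hbit : w.testBit (elemCode α) = false := by
    simpa [mem_decodeSet, hα] using hαw
  obtain ⟨g₀, h₀⟩ := decomps_unique w hw _ (elemCode_lt α) hbit
  have hmem : ∀ x, (x ∈ gopelCodes ∧ x &&& (x ^^^ w) = 1 <<< elemCode α ∧
      x ^^^ w ∈ rosenCodes) ↔ x = g₀ := by
    intro x
    rw [← mem_decomps, h₀, List.mem_singleton]
  obtain ⟨hg₀, hi₀, hr₀⟩ := (hmem g₀).2 rfl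
  refine ⟨(decodeSet g₀, decodeSet (g₀ ^^^ w)), ⟨?_, ?_, ?_, ?_⟩, ?_⟩
  · exact (gopel_codes _).2 ⟨_, hg₀, rfl⟩
  · exact (rosen_codes _).2 ⟨_, hr₀, rfl⟩
  · rw [decodeSet_and, hi₀, decodeSet_single hα]
  · rw [decodeSet_xor, Nat.xor_xor_cancel_left]
  · rintro ⟨G', R'⟩ ⟨hG', hR', hI, hW⟩
    obtain ⟨g', hg', rfl⟩ := (gopel_codes _).1 hG'
    obtain ⟨r', hr', rfl⟩ := (rosen_codes _).1 hR'
    simp only [decodeSet_xor, decodeSet_and] at hI hW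
    have hgl := codes_lt.1 g' hg'
    have hrl := codes_lt.2.1 r' hr'
    have hwe : w = g' ^^^ r' :=
      decodeSet_inj (codes_lt.2.2 w hw) (Nat.xor_lt_two_pow hgl hrl) hW
    have hre : g' ^^^ w = r' := by rw [hwe, Nat.xor_xor_cancel_left]
    have hie : g' &&& r' = 1 <<< elemCode α := by
      apply decodeSet_inj (Nat.and_lt_two_pow _ hrl)
      · rw [Nat.one_shiftLeft]
        exact Nat.pow_lt_pow_right (by norm_num) (elemCode_lt α)
      · rw [hI, decodeSet_single hα]
    have hge : g' = g₀ := (hmem g').1 ⟨hg', by rw [hre]; exact hie, by rw [hre]; exact hr'⟩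
    subst hge
    rw [hre]
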